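/- (Alexandrov; Borchers–Hegerfeld) Let n ≥ 3 and let f : ℝⁿ → ℝⁿ be a bijection such that for all p, q: η(p − q, p − q) = 0 if and only if η(f(p) − f(q), f(p) − f(q)) = 0 (f and f⁻¹ preserve lightlike separation). Then f is the composition of a dilation with an inhomogeneous Lorentz transformation: there exist λ > 0, a translation vector t ∈ ℝⁿ, and an n×n real matrix A satisfying η(A·v, A·w) = η(v, w) for all v, w, such that f(p) = λ • (A·p) + t for all p. -/

import Mathlib

noncomputable section

/-- The Minkowski bilinear form on `ℝⁿ`:
`η(v,w) = v₀ w₀ − ∑_{i≠0} vᵢ wᵢ`. -/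
def eta {n : ℕ} [NeZero n] (v w : Fin n → ℝ) : ℝ :=
  v 0 * w 0 - ∑ i ∈ Finset.univ.erase 0, v i * w i

end

section Minkowski

variable {n : ℕ} [NeZero n]

theorem eta_comm (v w : Fin n → ℝ) : eta v w = eta w v := by
  simp only [eta, mul_comm]

theorem eta_add_left (u v w : Fin n → ℝ) : eta (u + v) w = eta u w + eta v w := by
  simp only [eta, Pi.add_apply, add_mul, Finset.sum_add_distrib]; ring

theorem eta_smul_left (c : ℝ) (v w : Fin n → ℝ) : eta (c • v) w = c * eta v w := by
  simp only [eta, Pi.smul_apply, smul_eq_mul, mul_assoc, ← Finset.mul_sum]; ring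

theorem eta_add_right (u v w : Fin n → ℝ) : eta u (v + w) = eta u v + eta u w := by
  rw [eta_comm, eta_add_left, eta_comm v, eta_comm w]

theorem eta_smul_right (c : ℝ) (v w : Fin n → ℝ) : eta v (c • w) = c * eta v w := by
  rw [eta_comm, eta_smul_left, eta_comm]

theorem eta_neg_left (v w : Fin n → ℝ) : eta (-v) w = -eta v w := by
  rw [← neg_one_smul ℝ v, eta_smul_left]; ring

theorem eta_neg_right (v w : Fin n → ℝ) : eta v (-w) = -eta v w := by
  rw [eta_comm, eta_neg_left, eta_comm]

theorem eta_sub_left (u v w : Fin n → ℝ) : eta (u - v) w = eta u w - eta v w := by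
  rw [sub_eq_add_neg, eta_add_left, eta_neg_left]; ring

theorem eta_sub_right (u v w : Fin n → ℝ) : eta u (v - w) = eta u v - eta u w := by
  rw [sub_eq_add_neg, eta_add_right, eta_neg_right]; ring

theorem eta_self_sub (v w : Fin n → ℝ) :
    eta (v - w) (v - w) = eta v v - 2 * eta v w + eta w w := by
  rw [eta_sub_left, eta_sub_right, eta_sub_right, eta_comm w v]; ring

theorem eta_zero_left (v : Fin n → ℝ) : eta 0 v = 0 := by
  simp [eta]

/-- The unit vector of the time axis. -/
def timeUnit (n : ℕ) [NeZero n] : Fin n → ℝ := Pi.single 0 1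

@[simp] theorem timeUnit_zero : timeUnit n 0 = 1 := by
  simp [timeUnit]

theorem eta_timeUnit_left (v : Fin n → ℝ) : eta (timeUnit n) v = v 0 := by
  have : ∑ i ∈ Finset.univ.erase (0 : Fin n), timeUnit n i * v i = 0 :=
    Finset.sum_eq_zero fun i hi => by
      rw [timeUnit, Pi.single_eq_of_ne (Finset.ne_of_mem_erase hi), zero_mul]
  rw [eta, this]; simp

theorem eta_timeUnit_right (v : Fin n → ℝ) : eta v (timeUnit n) = v 0 := by
  rw [eta_comm, eta_timeUnit_left]

theorem eta_self_nonpos {x : Fin n → ℝ} (hx : x 0 = 0) : eta x x ≤ 0 := by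
  have : 0 ≤ ∑ i ∈ Finset.univ.erase (0 : Fin n), x i * x i :=
    Finset.sum_nonneg fun i _ => mul_self_nonneg _
  rw [eta, hx]; linarith

theorem eq_zero_of_eta_self {x : Fin n → ℝ} (hx : x 0 = 0) (h : eta x x = 0) : x = 0 := by
  have hs : ∑ i ∈ Finset.univ.erase (0 : Fin n), x i * x i = 0 := by
    rw [eta, hx] at h; linarith
  rw [Finset.sum_eq_zero_iff_of_nonneg fun i _ => mul_self_nonneg _] at hs
  funext i
  by_cases hi : i = 0
  · rw [hi, hx]; rfl
  · exact mul_self_eq_zero.1 (hs i (Finset.mem_erase.2 ⟨hi, Finset.mem_univ i⟩))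

theorem eta_self_neg {x : Fin n → ℝ} (hx : x 0 = 0) (h0 : x ≠ 0) : eta x x < 0 :=
  lt_of_le_of_ne (eta_self_nonpos hx) fun h => h0 (eq_zero_of_eta_self hx h)

theorem time_ne_zero {v : Fin n → ℝ} (hv : eta v v = 0) (h0 : v ≠ 0) : v 0 ≠ 0 :=
  fun h => h0 (eq_zero_of_eta_self h hv)

/-- Adding multiples of an orthogonal lightlike vector does not change `eta x x`. -/
theorem eta_self_sub_smul {v x : Fin n → ℝ} (hv : eta v v = 0) (h : eta v x = 0) (c : ℝ) :
    eta (x - c • v) (x - c • v) = eta x x := by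
  simp only [eta_sub_left, eta_sub_right, eta_smul_left, eta_smul_right, eta_comm x v, hv, h]
  ring

theorem eta_self_nonpos_of_orthogonal {v x : Fin n → ℝ} (hv : eta v v = 0) (h0 : v ≠ 0)
    (h : eta v x = 0) : eta x x ≤ 0 := by
  have hv0 := time_ne_zero hv h0
  rw [← eta_self_sub_smul hv h (x 0 / v 0)]
  apply eta_self_nonpos
  simp [hv0]

theorem exists_eq_smul_of_orthogonal {v x : Fin n → ℝ} (hv : eta v v = 0) (h0 : v ≠ 0)
    (h : eta v x = 0) (hx : eta x x = 0) : ∃ c : ℝ, x = c • v := by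
  have hv0 := time_ne_zero hv h0
  refine ⟨x 0 / v 0, sub_eq_zero.1 (eq_zero_of_eta_self ?_ ?_)⟩
  · simp [hv0]
  · rw [eta_self_sub_smul hv h, hx]

theorem exists_spacelike_unit_orthogonal (hn : 3 ≤ n) (v : Fin n → ℝ) :
    ∃ y : Fin n → ℝ, y 0 = 0 ∧ eta v y = 0 ∧ eta y y = -1 := by
  let L : (Fin n → ℝ) →ₗ[ℝ] (Fin 2 → ℝ) :=
    { toFun := fun x => ![x 0, eta v x]
      map_add' := fun x y => by
        ext i; fin_cases i <;> simp [eta_add_right]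
      map_smul' := fun c x => by
        ext i; fin_cases i <;> simp [eta_smul_right] }
  have hker : LinearMap.ker L ≠ ⊥ := LinearMap.ker_ne_bot_of_finrank_lt (by simp; omega)
  obtain ⟨x, hx, hx0⟩ := Submodule.exists_mem_ne_zero_of_ne_bot hker
  have h0 : x 0 = 0 := congrFun (LinearMap.mem_ker.1 hx) 0
  have h1 : eta v x = 0 := congrFun (LinearMap.mem_ker.1 hx) 1
  have hneg : 0 < -eta x x := neg_pos.2 (eta_self_neg h0 hx0)
  refine ⟨(√(-eta x x))⁻¹ • x, by simp [h0], by rw [eta_smul_right, h1, mul_zero], ?_⟩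
  have hs := Real.mul_self_sqrt hneg.le
  have hs0 := (Real.sqrt_pos.2 hneg).ne'
  rw [eta_smul_left, eta_smul_right]
  field_simp
  linarith

/-- Every vector is a sum of two lightlike vectors. -/
theorem exists_lightlike_add (hn : 3 ≤ n) (x : Fin n → ℝ) :
    ∃ a b : Fin n → ℝ, eta a a = 0 ∧ eta b b = 0 ∧ x = a + b := by
  obtain ⟨u, r, hu0, hu, hx⟩ : ∃ (u : Fin n → ℝ) (r : ℝ), u 0 = 0 ∧ eta u u = -1 ∧
      x = x 0 • timeUnit n + r • u := by
    set y := x - x 0 • timeUnit n with hy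
    have hy0 : y 0 = 0 := by simp [hy]
    by_cases h : y = 0
    · obtain ⟨u, hu0, -, hu⟩ := exists_spacelike_unit_orthogonal hn x
      exact ⟨u, 0, hu0, hu, by rw [zero_smul, add_zero]; exact sub_eq_zero.1 h⟩
    · have hneg : 0 < -eta y y := neg_pos.2 (eta_self_neg hy0 h)
      have hs := Real.mul_self_sqrt hneg.le
      have hs0 := (Real.sqrt_pos.2 hneg).ne'
      refine ⟨(√(-eta y y))⁻¹ • y, √(-eta y y), by simp [hy0], ?_, ?_⟩
      · rw [eta_smul_left, eta_smul_right]
        field_simp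
        linarith
      · rw [smul_inv_smul₀ hs0, hy]; abel
  refine ⟨((x 0 + r) / 2) • (timeUnit n + u), ((x 0 - r) / 2) • (timeUnit n - u), ?_, ?_, ?_⟩
  · simp [eta_add_left, eta_add_right, eta_smul_left, eta_smul_right, eta_timeUnit_left,
      eta_timeUnit_right, hu0, hu]
  · simp [eta_sub_left, eta_sub_right, eta_smul_left, eta_smul_right, eta_timeUnit_left,
      eta_timeUnit_right, hu0, hu]
  · conv_lhs => rw [hx]
    module

/-- A lightlike vector is a sum of three lightlike vectors in other directions. -/
theorem exists_lightlike_add_add (hn : 3 ≤ n) {v : Fin n → ℝ} (hv : eta v v = 0) (h0 : v ≠ 0) :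
    ∃ a b c : Fin n → ℝ, eta a a = 0 ∧ eta b b = 0 ∧ eta c c = 0 ∧
      eta v a ≠ 0 ∧ eta v b ≠ 0 ∧ eta v c ≠ 0 ∧ v = a + b + c := by
  have hv0 := time_ne_zero hv h0
  obtain ⟨y, hy0, hvy, hy⟩ := exists_spacelike_unit_orthogonal hn v
  refine ⟨v 0 • (timeUnit n + y), v 0 • (timeUnit n - y), v - (2 * v 0) • timeUnit n,
    ?_, ?_, ?_, ?_, ?_, ?_, by module⟩ <;>
  simp [eta_add_left, eta_add_right, eta_sub_left, eta_sub_right, eta_smul_left, eta_smul_right,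
      eta_timeUnit_left, eta_timeUnit_right, hy0, hy, hv, hvy, hv0]
  ring

section LightlikePreserving

variable {f : (Fin n → ℝ) → (Fin n → ℝ)}

/-- The image of a point of a lightlike line lies on the image line. -/
theorem exists_map_add_smul (hf : Function.Injective f)
    (h : ∀ p q, eta (p - q) (p - q) = 0 ↔ eta (f p - f q) (f p - f q) = 0)
    {v : Fin n → ℝ} (hv : eta v v = 0) (h0 : v ≠ 0) (p : Fin n → ℝ) (t : ℝ) :
    ∃ s : ℝ, f (p + t • v) = f p + s • (f (p + v) - f p) := by
  have h1 : eta (f (p + v) - f p) (f (p + v) - f p) = 0 := by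
    rw [← h]; simpa using hv
  have h2 : eta (f (p + t • v) - f p) (f (p + t • v) - f p) = 0 := by
    rw [← h]; simp [eta_smul_left, eta_smul_right, hv]
  have h3 : eta ((f (p + v) - f p) - (f (p + t • v) - f p))
      ((f (p + v) - f p) - (f (p + t • v) - f p)) = 0 := by
    rw [sub_sub_sub_cancel_right, ← h]
    simp [eta_sub_left, eta_sub_right, eta_smul_left, eta_smul_right, hv]
  have h4 : eta (f (p + v) - f p) (f (p + t • v) - f p) = 0 := by
    rw [eta_self_sub, h1, h2] at h3
    linarith
  obtain ⟨s, hs⟩ := exists_eq_smul_of_orthogonal h1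
    (fun h' => h0 (by simpa using hf (sub_eq_zero.1 h'))) h4 h2
  exact ⟨s, by rw [← hs]; abel⟩

/-- Every point of the image of a lightlike line is the image of a point. -/
theorem exists_map_eq_add_smul (hf : Function.Bijective f)
    (h : ∀ p q, eta (p - q) (p - q) = 0 ↔ eta (f p - f q) (f p - f q) = 0)
    {v : Fin n → ℝ} (hv : eta v v = 0) (h0 : v ≠ 0) (p : Fin n → ℝ) (s : ℝ) :
    ∃ t : ℝ, f (p + t • v) = f p + s • (f (p + v) - f p) := by
  let e := Equiv.ofBijective f hf
  have he : ∀ x, e x = f x := fun _ => rfl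
  have hs : ∀ p q, eta (p - q) (p - q) = 0 ↔
      eta (e.symm p - e.symm q) (e.symm p - e.symm q) = 0 := fun p q => by
    rw [h (e.symm p), ← he (e.symm p), ← he (e.symm q), e.apply_symm_apply, e.apply_symm_apply]
  have h1 : eta (f (p + v) - f p) (f (p + v) - f p) = 0 := by
    rw [← h]; simpa using hv
  obtain ⟨t, ht⟩ := exists_map_add_smul e.symm.injective hs h1
    (fun h' => h0 (by simpa using hf.1 (sub_eq_zero.1 h'))) (f p) s
  refine ⟨t, ?_⟩
  rw [add_sub_cancel, ← he, ← he, e.symm_apply_apply, e.symm_apply_apply, add_sub_cancel_left,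
    e.symm_apply_eq] at ht
  rw [← he, ← ht, he, he]

/-- Opposite lightlike sides of a parallelogram have parallel images. -/
theorem exists_map_sub_eq_smul (hf : Function.Bijective f)
    (h : ∀ p q, eta (p - q) (p - q) = 0 ↔ eta (f p - f q) (f p - f q) = 0)
    {v w : Fin n → ℝ} (hv : eta v v = 0) (hw : eta w w = 0) (hvw : eta v w ≠ 0)
    (p : Fin n → ℝ) :
    ∃ c : ℝ, f (p + w + v) - f (p + w) = c • (f (p + v) - f p) := by
  have h0 : v ≠ 0 := by rintro rfl; exact hvw (eta_zero_left w)
  have hv' : eta (f (p + v) - f p) (f (p + v) - f p) = 0 := by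
    rw [← h]; simpa using hv
  have hu' : eta (f (p + w + v) - f (p + w)) (f (p + w + v) - f (p + w)) = 0 := by
    rw [← h]; simpa using hv
  refine exists_eq_smul_of_orthogonal hv'
    (fun h' => h0 (by simpa using hf.1 (sub_eq_zero.1 h'))) ?_ hu'
  by_contra hne
  -- a point of the second line related to either all or no points of the first
  obtain ⟨r, hr⟩ := exists_map_eq_add_smul hf h hv h0 (p + w)
    (-eta (f (p + v) - f p) (f (p + w) - f p) /
      eta (f (p + v) - f p) (f (p + w + v) - f (p + w)))
  have horth : eta (f (p + v) - f p) (f (p + w + r • v) - f p) = 0 := by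
    rw [hr, add_sub_right_comm, eta_add_right, eta_smul_right]
    field_simp
    ring
  have hind : ∀ t : ℝ, eta (p + w + r • v - (p + t • v)) (p + w + r • v - (p + t • v)) = 0 ↔
      eta (f (p + w + r • v) - f p) (f (p + w + r • v) - f p) = 0 := fun t => by
    obtain ⟨s, hs⟩ := exists_map_add_smul hf.1 h hv h0 p t
    rw [h, hs, ← sub_sub, eta_self_sub_smul hv' horth]
  have e1 : p + w + r • v - (p + r • v) = w := by module
  have e2 : p + w + r • v - (p + (r + 1) • v) = w - v := by module
  have h1 := (hind (r + 1)).2 ((hind r).1 (by rw [e1, hw]))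
  rw [e2] at h1
  simp only [eta_sub_left, eta_sub_right, hv, hw, eta_comm w v] at h1
  exact hvw (by linarith)

theorem map_add_add_of_lightlike (hf : Function.Bijective f)
    (h : ∀ p q, eta (p - q) (p - q) = 0 ↔ eta (f p - f q) (f p - f q) = 0)
    {v w : Fin n → ℝ} (hv : eta v v = 0) (hw : eta w w = 0) (hvw : eta v w ≠ 0)
    (p : Fin n → ℝ) :
    f (p + w + v) - f (p + w) = f (p + v) - f p := by
  obtain ⟨c, hc⟩ := exists_map_sub_eq_smul hf h hv hw hvw p
  obtain ⟨d, hd⟩ := exists_map_sub_eq_smul hf h hw hv (by rwa [eta_comm]) p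
  have hv' : eta (f (p + v) - f p) (f (p + v) - f p) = 0 := by
    rw [← h]; simpa using hv
  have hw' : eta (f (p + w) - f p) (f (p + w) - f p) = 0 := by
    rw [← h]; simpa using hw
  have hne : eta (f (p + w) - f p) (f (p + v) - f p) ≠ 0 := by
    intro h'
    have h1 : eta (f (p + w) - f (p + v)) (f (p + w) - f (p + v)) = 0 := by
      rw [← sub_sub_sub_cancel_right _ _ (f p), eta_self_sub, hv', hw', h']
      ring
    rw [← h, add_sub_add_left_eq_sub, eta_self_sub, hv, hw, eta_comm w v] at h1
    exact hvw (by linarith)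
  have key : (c - 1) • (f (p + v) - f p) = (d - 1) • (f (p + w) - f p) := by
    rw [sub_smul, sub_smul, ← hc, ← hd, add_right_comm]
    module
  have h2 := congrArg (eta (f (p + w) - f p)) key
  rw [eta_smul_right, eta_smul_right, hw', mul_zero] at h2
  have hc1 : c = 1 := by
    have := (mul_eq_zero.1 h2).resolve_right hne
    linarith
  rw [hc, hc1, one_smul]

/-- Up to a translation, `f` is additive. -/
theorem map_add_sub (hn : 3 ≤ n) (hf : Function.Bijective f)
    (h : ∀ p q, eta (p - q) (p - q) = 0 ↔ eta (f p - f q) (f p - f q) = 0)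
    (p q : Fin n → ℝ) : f (p + q) - f 0 = (f p - f 0) + (f q - f 0) := by
  have hnull : ∀ v w : Fin n → ℝ, eta v v = 0 → eta w w = 0 → ∀ p,
      f (p + w + v) - f (p + w) = f (p + v) - f p := by
    intro v w hv hw p
    by_cases hvw : eta v w = 0
    · by_cases hw0 : w = 0
      · simp [hw0]
      by_cases hv0 : v = 0
      · simp [hv0]
      obtain ⟨k, rfl⟩ := exists_eq_smul_of_orthogonal hw hw0 (by rwa [eta_comm]) hv
      have hk : k ≠ 0 := by rintro rfl; simp at hv0
      obtain ⟨a, b, c, ha, hb, hc, hwa, hwb, hwc, e⟩ := exists_lightlike_add_add hn hw hw0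
      have hadd : ∀ x, eta x x = 0 → eta w x ≠ 0 → ∀ p,
          f (p + x + k • w) - f (p + x) = f (p + k • w) - f p := fun x hx hwx p =>
        map_add_add_of_lightlike hf h hv hx (by rw [eta_smul_left]; exact mul_ne_zero hk hwx) p
      have e' : p + w = p + a + b + c := by
        conv_lhs => rw [e]
        abel
      rw [e', hadd c hc hwc, hadd b hb hwb, hadd a ha hwa]
    · exact map_add_add_of_lightlike hf h hv hw hvw p
  have htrans : ∀ v : Fin n → ℝ, eta v v = 0 → ∀ p, f (p + v) - f p = f v - f 0 := by
    intro v hv p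
    obtain ⟨a, b, ha, hb, rfl⟩ := exists_lightlike_add hn p
    have h1 := hnull v b hv hb a
    have h2 := hnull v a hv ha 0
    simp only [zero_add] at h2
    rw [h1, h2]
  obtain ⟨a, b, ha, hb, rfl⟩ := exists_lightlike_add hn q
  have h1 := htrans b hb (p + a)
  have h2 := htrans a ha p
  have h3 := htrans b hb a
  rw [← add_assoc, eq_add_of_sub_eq h1, eq_add_of_sub_eq h2, eq_add_of_sub_eq h3]
  abel

end LightlikePreserving

/-- A positive additive function on the reals with value `1` at `1` is the identity. -/
theorem additive_eq_self {σ : ℝ → ℝ} (hadd : ∀ s t, σ (s + t) = σ s + σ t) (hone : σ 1 = 1)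
    (hpos : ∀ t, 0 < t → 0 < σ t) (t : ℝ) : σ t = t := by
  let g : ℝ →+ ℝ := AddMonoidHom.mk' σ hadd
  have hg : ∀ x, g x = σ x := fun _ => rfl
  have hrat : ∀ q : ℚ, g q = q := fun q => by
    have := map_rat_smul g q (1 : ℝ)
    rw [hg 1, hone] at this
    simpa [Rat.smul_def] using this
  have hmono : ∀ s t, s < t → g s < g t := fun s t hst => by
    have := hpos (t - s) (sub_pos.2 hst)
    rw [← hg, map_sub] at this
    linarith
  rw [← hg]
  rcases lt_trichotomy (g t) t with hlt | heq | hgt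
  · obtain ⟨q, hq, hq'⟩ := exists_rat_btwn hlt
    have := hmono _ _ hq'
    rw [hrat] at this
    linarith
  · exact heq
  · obtain ⟨q, hq, hq'⟩ := exists_rat_btwn hgt
    have := hmono _ _ hq
    rw [hrat] at this
    linarith

section Additive

variable {F : (Fin n → ℝ) →+ (Fin n → ℝ)}

theorem lightlike_sub_iff (h : ∀ p, eta p p = 0 ↔ eta (F p) (F p) = 0) (p q : Fin n → ℝ) :
    eta (p - q) (p - q) = 0 ↔ eta (F p - F q) (F p - F q) = 0 := by
  rw [h, map_sub]

/-- Orthogonality of a vector to a lightlike vector is preserved. -/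
theorem eta_map_eq_zero (hF : Function.Bijective F)
    (h : ∀ p, eta p p = 0 ↔ eta (F p) (F p) = 0) {v p : Fin n → ℝ} (hv : eta v v = 0)
    (hp : eta p p ≠ 0) (hvp : eta v p = 0) : eta (F v) (F p) = 0 := by
  by_cases h0 : v = 0
  · rw [h0, map_zero, eta_zero_left]
  by_contra hne
  obtain ⟨t, ht⟩ := exists_map_eq_add_smul hF (lightlike_sub_iff h) hv h0 0
    (eta (F p) (F p) / (2 * eta (F v) (F p)))
  simp only [zero_add, map_zero, sub_zero] at ht
  apply hp
  rw [← eta_self_sub_smul hv hvp t, h, map_sub, ht]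
  simp only [eta_sub_left, eta_sub_right, eta_smul_left, eta_smul_right, eta_comm (F p) (F v),
    (h v).1 hv]
  field_simp
  ring

/-- The spacelike combinations of `v` and its time reflection have spacelike images. -/
theorem eta_map_neg (hn : 3 ≤ n) (hF : Function.Bijective F)
    (h : ∀ p, eta p p = 0 ↔ eta (F p) (F p) = 0) {v : Fin n → ℝ} (hv : eta v v = 0)
    (h0 : v ≠ 0) {t : ℝ} (ht : 0 < t) :
    eta (F (t • v - ((2 * v 0) • timeUnit n - v))) (F (t • v - ((2 * v 0) • timeUnit n - v)))
      < 0 := by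
  have hv0 := time_ne_zero hv h0
  obtain ⟨y, hy0, hvy, hy⟩ := exists_spacelike_unit_orthogonal hn v
  have hyv : eta y v = 0 := by rw [eta_comm, hvy]
  set p := t • v - ((2 * v 0) • timeUnit n - v) with hp
  set z := t • v + ((2 * v 0) • timeUnit n - v) + (2 * √t * v 0) • y with hz
  have hs := Real.mul_self_sqrt ht.le
  have hz2 : eta z z = 0 := by
    simp only [hz, eta_add_left, eta_add_right, eta_sub_left, eta_sub_right, eta_smul_left,
      eta_smul_right, eta_timeUnit_left, eta_timeUnit_right, timeUnit_zero, Pi.add_apply,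
      Pi.sub_apply, Pi.smul_apply, smul_eq_mul, hy0, hy, hvy, hyv, hv]
    linear_combination (-4 * v 0 ^ 2) * hs
  have hp2 : eta p p = -4 * t * v 0 ^ 2 := by
    simp only [hp, eta_sub_left, eta_sub_right, eta_smul_left,
      eta_smul_right, eta_timeUnit_left, eta_timeUnit_right, timeUnit_zero,
      Pi.sub_apply, Pi.smul_apply, smul_eq_mul, hv]
    ring
  have hzp : eta z p = 0 := by
    simp only [hz, hp, eta_add_left, eta_sub_left, eta_sub_right, eta_smul_left,
      eta_smul_right, eta_timeUnit_left, eta_timeUnit_right, timeUnit_zero, Pi.add_apply,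
      Pi.sub_apply, Pi.smul_apply, smul_eq_mul, hy0, hyv, hv]
    ring
  have hpne : eta p p ≠ 0 := by
    rw [hp2]; simp [hv0, ht.ne']
  have hz0 : z ≠ 0 := by
    intro hz0
    have h1 : z 0 = (t + 1) * v 0 := by
      simp [hz, hy0]; ring
    rw [hz0] at h1
    exact mul_ne_zero (by linarith) hv0 h1.symm
  refine lt_of_le_of_ne (eta_self_nonpos_of_orthogonal ((h z).1 hz2) ?_
    (eta_map_eq_zero hF h hz2 hpne hzp)) fun h' => hpne ((h p).2 h')
  rwa [Ne, map_eq_zero_iff F hF.1]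

theorem map_smul_of_lightlike (hn : 3 ≤ n) (hF : Function.Bijective F)
    (h : ∀ p, eta p p = 0 ↔ eta (F p) (F p) = 0) {v : Fin n → ℝ} (hv : eta v v = 0)
    (t : ℝ) : F (t • v) = t • F v := by
  by_cases h0 : v = 0
  · simp [h0]
  have hFv : F v ≠ 0 := by rwa [Ne, map_eq_zero_iff F hF.1]
  have hex : ∀ t : ℝ, ∃ s : ℝ, F (t • v) = s • F v := fun t => by
    simpa using exists_map_add_smul hF.1 (lightlike_sub_iff h) hv h0 0 t
  choose σ hσ using hex
  rw [hσ, additive_eq_self (σ := σ)]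
  · intro s t
    apply smul_left_injective ℝ hFv
    simp only [add_smul, ← hσ, map_add]
  · apply smul_left_injective ℝ hFv
    simp only [← hσ, one_smul]
  · intro t ht
    have hw : eta ((2 * v 0) • timeUnit n - v) ((2 * v 0) • timeUnit n - v) = 0 := by
      simp only [eta_sub_left, eta_sub_right, eta_smul_left, eta_smul_right, eta_timeUnit_left,
        eta_timeUnit_right, timeUnit_zero,
      Pi.sub_apply, Pi.smul_apply, smul_eq_mul, hv]
      ring
    have key : ∀ t : ℝ, 0 < t → 0 < σ t * eta (F v) (F ((2 * v 0) • timeUnit n - v)) := by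
      intro t ht
      have := eta_map_neg hn hF h hv h0 ht
      rw [map_sub, hσ, eta_sub_left, eta_sub_right, eta_sub_right, (h _).1 hw,
        eta_smul_left, eta_smul_left, eta_smul_right, eta_smul_right, (h _).1 hv,
        eta_comm _ (F v)] at this
      linarith
    have h1 : σ 1 = 1 := by
      apply smul_left_injective ℝ hFv
      simp only [← hσ, one_smul]
    have k1 := key 1 one_pos
    rw [h1, one_mul] at k1
    exact pos_of_mul_pos_left (key t ht) k1.le

theorem map_smul_of_lightlike_iff (hn : 3 ≤ n) (hF : Function.Bijective F)
    (h : ∀ p, eta p p = 0 ↔ eta (F p) (F p) = 0) (t : ℝ) (p : Fin n → ℝ) :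
    F (t • p) = t • F p := by
  obtain ⟨a, b, ha, hb, rfl⟩ := exists_lightlike_add hn p
  rw [smul_add, map_add, map_add, map_smul_of_lightlike hn hF h ha,
    map_smul_of_lightlike hn hF h hb, smul_add]

end Additive

/-- A linear map preserving the light cone is conformal. -/
theorem eta_map_self {L : (Fin n → ℝ) →ₗ[ℝ] (Fin n → ℝ)}
    (h : ∀ p, eta p p = 0 → eta (L p) (L p) = 0) (p : Fin n → ℝ) :
    eta (L p) (L p) = eta (L (timeUnit n)) (L (timeUnit n)) * eta p p := by
  set y := p - p 0 • timeUnit n with hy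
  have hy0 : y 0 = 0 := by simp [hy]
  have hp : p = p 0 • timeUnit n + y := by rw [hy]; abel
  by_cases hyz : y = 0
  · rw [hyz, add_zero] at hp
    have e : eta p p = p 0 * p 0 := by
      conv_lhs => rw [hp]
      simp [eta_smul_left, eta_smul_right, eta_timeUnit_left]
    rw [e]
    conv_lhs => rw [hp]
    rw [map_smul, eta_smul_left, eta_smul_right]
    ring
  have hneg : 0 < -eta y y := neg_pos.2 (eta_self_neg hy0 hyz)
  have hs := Real.mul_self_sqrt hneg.le
  have hs0 := (Real.sqrt_pos.2 hneg).ne'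
  set r := √(-eta y y)
  have h1 := h (r • timeUnit n + y) (by
    simp only [eta_add_left, eta_add_right, eta_smul_left, eta_smul_right, eta_timeUnit_left,
      eta_timeUnit_right, timeUnit_zero, Pi.add_apply,
      Pi.smul_apply, smul_eq_mul, hy0]
    linear_combination hs)
  have h2 := h (r • timeUnit n - y) (by
    simp only [eta_sub_left, eta_sub_right, eta_smul_left, eta_smul_right, eta_timeUnit_left,
      eta_timeUnit_right, timeUnit_zero,
      Pi.sub_apply, Pi.smul_apply, smul_eq_mul, hy0]
    linear_combination hs)
  simp only [map_add, map_sub, map_smul, eta_add_left, eta_add_right, eta_sub_left, eta_sub_right,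
    eta_smul_left, eta_smul_right, eta_comm (L y) (L (timeUnit n))] at h1 h2
  have h3 : eta (L (timeUnit n)) (L y) = 0 := by
    have : r * eta (L (timeUnit n)) (L y) = 0 := by linarith
    exact (mul_eq_zero.1 this).resolve_left hs0
  have e : eta p p = p 0 * p 0 + eta y y := by
    conv_lhs => rw [hp]
    simp only [eta_add_left, eta_add_right, eta_smul_left, eta_smul_right, eta_timeUnit_left,
      eta_timeUnit_right, timeUnit_zero, Pi.add_apply,
      Pi.smul_apply, smul_eq_mul, hy0]
    ring
  rw [e]
  conv_lhs => rw [hp]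
  simp only [map_add, map_smul, eta_add_left, eta_add_right,
    eta_smul_left, eta_smul_right, eta_comm (L y) (L (timeUnit n)), h3] at h1 ⊢
  linear_combination h1 - eta (L (timeUnit n)) (L (timeUnit n)) * hs

theorem eta_map_map {L : (Fin n → ℝ) →ₗ[ℝ] (Fin n → ℝ)} {c : ℝ}
    (h : ∀ p, eta (L p) (L p) = c * eta p p) (p q : Fin n → ℝ) :
    eta (L p) (L q) = c * eta p q := by
  have h1 := h (p + q)
  simp only [map_add, eta_add_left, eta_add_right, h, eta_comm q p, eta_comm (L q) (L p)] at h1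
  linarith

end Minkowski

open Matrix in
/-- **Alexandrov's theorem** (Borchers–Hegerfeld version): a bijection of `ℝⁿ`
(`n ≥ 3`) which together with its inverse preserves lightlike separation is
the composition of a dilation with an inhomogeneous Lorentz transformation. -/
theorem alexandrov_lightlike {n : ℕ} [NeZero n] (hn : 3 ≤ n)
    (f : (Fin n → ℝ) → (Fin n → ℝ)) (hf : Function.Bijective f)
    (hlight : ∀ p q : Fin n → ℝ,
      eta (p - q) (p - q) = 0 ↔ eta (f p - f q) (f p - f q) = 0) :
    ∃ (lam : ℝ) (t : Fin n → ℝ) (A : Matrix (Fin n) (Fin n) ℝ),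
      0 < lam ∧ (∀ v w, eta (A *ᵥ v) (A *ᵥ w) = eta v w) ∧
      ∀ p, f p = lam • (A *ᵥ p) + t := by
  let F : (Fin n → ℝ) →+ (Fin n → ℝ) :=
    AddMonoidHom.mk' (fun p => f p - f 0) (map_add_sub hn hf hlight)
  have hFf : ∀ p, F p = f p - f 0 := fun _ => rfl
  have hF : Function.Bijective F := (Equiv.subRight (f 0)).bijective.comp hf
  have h : ∀ p, eta p p = 0 ↔ eta (F p) (F p) = 0 := fun p => by
    rw [hFf, ← hlight, sub_zero]
  let L : (Fin n → ℝ) →ₗ[ℝ] (Fin n → ℝ) :=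
    { F with map_smul' := map_smul_of_lightlike_iff hn hF h }
  have hL : ∀ p, L p = F p := fun _ => rfl
  set c := eta (L (timeUnit n)) (L (timeUnit n)) with hc
  have hself : ∀ p, eta (L p) (L p) = c * eta p p := eta_map_self fun p => (h p).1
  have hcpos : 0 < c := by
    obtain ⟨y, hy0, -, hy⟩ := exists_spacelike_unit_orthogonal hn (0 : Fin n → ℝ)
    have hv : eta (timeUnit n + y) (timeUnit n + y) = 0 := by
      simp [eta_add_left, eta_add_right, eta_timeUnit_left, eta_timeUnit_right, hy0, hy]
    have hv0 : (timeUnit n + y) 0 = 1 := by simp [hy0]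
    have hneg := eta_map_neg hn hF h hv (fun h0 => by rw [h0] at hv0; simp at hv0) one_pos
    rw [← hL, hself] at hneg
    simp only [hv0, eta_sub_left, eta_sub_right, eta_smul_left, eta_smul_right, eta_add_left,
      eta_add_right, eta_timeUnit_left, eta_timeUnit_right, timeUnit_zero,
      Pi.sub_apply, Pi.smul_apply, smul_eq_mul, hy0, hy] at hneg
    linarith
  have hs := Real.mul_self_sqrt hcpos.le
  have hs0 := Real.sqrt_pos.2 hcpos
  have hA : ∀ p, LinearMap.toMatrix' ((√c)⁻¹ • L) *ᵥ p = (√c)⁻¹ • L p := fun p => by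
    rw [LinearMap.toMatrix'_mulVec, LinearMap.smul_apply]
  refine ⟨√c, f 0, LinearMap.toMatrix' ((√c)⁻¹ • L), hs0, fun v w => ?_, fun p => ?_⟩
  · rw [hA, hA, eta_smul_left, eta_smul_right, eta_map_map hself]
    field_simp
    rw [sq, hs]
  · rw [hA, smul_inv_smul₀ hs0.ne', hL, hFf, sub_add_cancel]
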